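/- Let P_1,…,P_s ∈ ℤ[x_1,…,x_r] (s ≥ 2, r ≥ 2) be nonzero coprime polynomials of total degree at most d. Then for all sufficiently large primes p one has c_p ≤ d^s · p^{r−2}; consequently c_p/p^r = O(1/p²) as p → ∞ over primes. -/

import Mathlib

open MvPolynomial

lemma two_mul_finrank_restrictTotalDegree_fin_two (F : Type*) [Field F] (k : ℕ) :
    2 * Module.finrank F (restrictTotalDegree (Fin 2) F k) = (k + 1) * (k + 2) := by
  classical
  have hset : {n : Fin 2 →₀ ℕ | (n.sum fun _ e => e) ≤ k} =
      ↑((Finset.range (k + 1)).biUnion fun i => Finset.finsuppAntidiag (.univ : Finset (Fin 2)) i) := by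
    ext n
    simp [Finset.mem_finsuppAntidiag, Finsupp.sum_fintype]
  have hcard := Module.finrank_eq_nat_card_basis
    (basisRestrictSupport F {n : Fin 2 →₀ ℕ | (n.sum fun _ e => e) ≤ k})
  rw [Nat.card_coe_set_eq, hset, Set.ncard_coe_finset, Finset.card_biUnion] at hcard
  · have hi : ∀ i : ℕ, (Finset.finsuppAntidiag (.univ : Finset (Fin 2)) i).card = i + 1 := by
      intro i
      rw [Finset.card_finsuppAntidiag_nat_eq_choose]
      simp [Nat.add_comm 1 i]
    rw [Finset.sum_congr rfl fun i _ => hi i, ← Finset.sum_range_succ' (fun i => i) (k + 1)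
      |>.trans (add_zero _)] at hcard
    rw [restrictTotalDegree, hset, hcard, mul_comm, Finset.sum_range_id_mul_two]
    simp [mul_comm]
  · intro i _ j _ hij
    rw [Function.onFun, Finset.disjoint_left]
    intro n hi hj
    rw [Finset.mem_finsuppAntidiag] at hi hj
    exact hij (hi.1.symm.trans hj.1)

/-- A polynomial of degree at most `#Z` that separates `z` from the other points of `Z`. -/
lemma exists_totalDegree_le_eval_eq {F : Type*} [Field F] {σ : Type*} (Z : Finset (σ → F))
    (z : σ → F) :
    ∃ L : MvPolynomial σ F, L.totalDegree ≤ Z.card ∧ eval z L ≠ 0 ∧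
      ∀ z' ∈ Z, z' ≠ z → eval z' L = 0 := by
  classical
  have h : ∀ z' : σ → F, ∃ l : MvPolynomial σ F, l.totalDegree ≤ 1 ∧ eval z l ≠ 0 ∧
      (z' ≠ z → eval z' l = 0) := by
    intro z'
    by_cases hz : z' = z
    · exact ⟨1, by simp, by simp, fun h => (h hz).elim⟩
    · obtain ⟨i, hi⟩ := Function.ne_iff.mp hz
      refine ⟨X i - C (z' i), ?_, ?_, ?_⟩
      · rw [sub_eq_add_neg, ← C_neg]
        refine (totalDegree_add _ _).trans ?_
        simp
      · simpa [sub_eq_zero] using hi.symm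
      · simp
  choose l hl1 hl2 hl3 using h
  refine ⟨∏ z' ∈ Z, l z', ?_, ?_, ?_⟩
  · refine (totalDegree_finsetProd _ _).trans ?_
    simpa using Finset.sum_le_card_nsmul Z _ 1 fun z' _ => hl1 z'
  · rw [eval_prod]
    exact Finset.prod_ne_zero_iff.mpr fun z' _ => hl2 z'
  · intro z' hz' hne
    rw [eval_prod]
    exact Finset.prod_eq_zero hz' (hl3 z' hne)

/-- Bézout's bound for affine plane curves: two coprime polynomials in two variables have at most
`deg f * deg g` common zeros. -/
theorem card_common_zeros_le_of_isRelPrime {F : Type*} [Field F] {f g : MvPolynomial (Fin 2) F}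
    (hfg : IsRelPrime f g) (Z : Finset (Fin 2 → F)) (hf : ∀ z ∈ Z, eval z f = 0)
    (hg : ∀ z ∈ Z, eval z g = 0) : Z.card ≤ f.totalDegree * g.totalDegree := by
  classical
  rcases Z.eq_empty_or_nonempty with rfl | ⟨z₀, hz₀⟩
  · simp
  have hu : ∀ u : MvPolynomial (Fin 2) F, IsUnit u → eval z₀ u ≠ 0 := fun u h =>
    (h.map (eval z₀)).ne_zero
  have hf0 : f ≠ 0 := by
    rintro rfl
    exact hu g (isRelPrime_zero_left.mp hfg) (hg _ hz₀)
  have hg0 : g ≠ 0 := by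
    rintro rfl
    exact hu f (isRelPrime_zero_right.mp hfg) (hf _ hz₀)
  set D := f.totalDegree with hD
  set e := g.totalDegree with he
  set N := Z.card with hN
  let V := restrictTotalDegree (Fin 2) F
  have mem_mul : ∀ {i j k : ℕ} {p q : MvPolynomial (Fin 2) F}, p ∈ V i →
      q.totalDegree ≤ j → i + j ≤ k → p * q ∈ V k := by
    intro i j k p q hp hq h
    rw [mem_restrictTotalDegree] at hp ⊢
    exact (totalDegree_mul _ _).trans (by omega)
  let mulf : V (e + N) →ₗ[F] V (D + e + N) := (LinearMap.mulRight F f).restrict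
    fun a ha => mem_mul ha hD.ge (by omega)
  let mulg : V (D + N) →ₗ[F] V (D + e + N) := (LinearMap.mulRight F g).restrict
    fun a ha => mem_mul ha he.ge (by omega)
  let syzg : V N →ₗ[F] V (e + N) := (LinearMap.mulRight F g).restrict
    fun a ha => mem_mul ha he.ge (by omega)
  let syzf : V N →ₗ[F] V (D + N) := (LinearMap.mulRight F (-f)).restrict
    fun a ha => mem_mul ha (by rw [totalDegree_neg]) (by omega)
  have mulf_apply : ∀ a, (mulf a : MvPolynomial (Fin 2) F) = a * f := fun _ => rfl
  have mulg_apply : ∀ a, (mulg a : MvPolynomial (Fin 2) F) = a * g := fun _ => rfl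
  have syzg_apply : ∀ a, (syzg a : MvPolynomial (Fin 2) F) = a * g := fun _ => rfl
  have syzf_apply : ∀ a, (syzf a : MvPolynomial (Fin 2) F) = a * -f := fun _ => rfl
  let Φ := mulf.coprod mulg
  let Ψ := syzg.prod syzf
  let ev : V (D + e + N) →ₗ[F] (Z → F) :=
    (LinearMap.pi fun z : Z => (aeval (R := F) z.1).toLinearMap).domRestrict (V (D + e + N))
  have hΦev : LinearMap.range Φ ≤ LinearMap.ker ev := by
    rintro _ ⟨⟨a, b⟩, rfl⟩
    ext z
    simp [Φ, ev, mulf_apply, mulg_apply, aeval_eq_eval, hf z.1 z.2, hg z.1 z.2]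
  have hev : LinearMap.range ev = ⊤ := by
    rw [LinearMap.range_eq_top]
    intro c
    choose L hL1 hL2 hL3 using exists_totalDegree_le_eval_eq (F := F) (σ := Fin 2) Z
    refine ⟨⟨∑ z : Z, (c z / eval z.1 (L z.1)) • L z.1, ?_⟩, ?_⟩
    · refine Submodule.sum_mem _ fun z _ => Submodule.smul_mem _ _ ?_
      rw [mem_restrictTotalDegree]
      exact (hL1 _).trans (by omega)
    · ext z
      simp only [ev, LinearMap.domRestrict_apply, LinearMap.pi_apply, AlgHom.toLinearMap_apply,
        map_sum, map_smul, aeval_eq_eval, smul_eq_mul]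
      rw [Finset.sum_eq_single z]
      · simp [hL2]
      · intro z' _ hne
        have := hL3 z'.1 z.1 z.2 (fun h => hne (Subtype.ext h.symm))
        simp [this]
      · simp
  have hΨ : LinearMap.ker Φ ≤ LinearMap.range Ψ := by
    rintro ⟨⟨a, ha⟩, ⟨b, hb⟩⟩ hab
    have hab : a * f + b * g = 0 := by simpa [Φ, mulf_apply, mulg_apply, Subtype.ext_iff] using hab
    have hga : g ∣ a := hfg.symm.dvd_of_dvd_mul_right ⟨-b, by linear_combination hab⟩
    obtain ⟨c, rfl⟩ := hga
    have hbc : b = c * -f := mul_right_cancel₀ hg0 (by linear_combination hab)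
    have hc : c ∈ V N := by
      rw [mem_restrictTotalDegree] at ha ⊢
      rcases eq_or_ne c 0 with rfl | hc0
      · simp
      · rw [totalDegree_mul_of_isDomain hg0 hc0] at ha
        omega
    refine ⟨⟨c, hc⟩, ?_⟩
    simp [Ψ, syzg_apply, syzf_apply, Subtype.ext_iff, hbc, mul_comm]
  have h1 := LinearMap.finrank_range_add_finrank_ker Φ
  have h2 := LinearMap.finrank_range_add_finrank_ker ev
  have h3 := Submodule.finrank_mono hΦev
  have h4 := (Submodule.finrank_mono hΨ).trans (LinearMap.finrank_range_le Ψ)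
  rw [hev, finrank_top, Module.finrank_fintype_fun_eq_card, Fintype.card_coe] at h2
  rw [Module.finrank_prod] at h1
  have t1 := two_mul_finrank_restrictTotalDegree_fin_two F (D + e + N)
  have t2 := two_mul_finrank_restrictTotalDegree_fin_two F (D + N)
  have t3 := two_mul_finrank_restrictTotalDegree_fin_two F (e + N)
  have t4 := two_mul_finrank_restrictTotalDegree_fin_two F N
  simp only [V] at h1 h2 h3 h4
  nlinarith

/-- Substituting the parametrized line `a + t v` into a polynomial. -/
noncomputable def lineHom {σ R S : Type*} [CommRing R] [CommRing S] (φ : R →+* S) (a v : σ → S) :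
    MvPolynomial σ R →+* Polynomial S :=
  eval₂Hom (Polynomial.C.comp φ) fun i =>
    Polynomial.C (a i) + Polynomial.C (v i) * Polynomial.X

section lineHom

variable {σ R S : Type*} [CommRing R] [CommRing S]

lemma mapRingHom_comp_lineHom {T : Type*} [CommRing T] (φ : R →+* S) (a v : σ → S) (ψ : S →+* T) :
    (Polynomial.mapRingHom ψ).comp (lineHom φ a v) =
      lineHom (ψ.comp φ) (fun i => ψ (a i)) (fun i => ψ (v i)) := by
  ext <;> simp [lineHom]

lemma map_lineHom {T : Type*} [CommRing T] (φ : R →+* S) (a v : σ → S) (ψ : S →+* T)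
    (P : MvPolynomial σ R) :
    (lineHom φ a v P).map ψ = lineHom (ψ.comp φ) (fun i => ψ (a i)) (fun i => ψ (v i)) P :=
  RingHom.congr_fun (mapRingHom_comp_lineHom φ a v ψ) P

lemma lineHom_map {T : Type*} [CommRing T] (φ : R →+* S) (a v : σ → S) (ψ : T →+* R)
    (P : MvPolynomial σ T) :
    lineHom φ a v (map ψ P) = lineHom (φ.comp ψ) a v P := by
  simp [lineHom, RingHom.comp_assoc]

lemma natDegree_coeff_lineHom_monomial_one (φ : R →+* S) (a v : σ → S) (m : σ →₀ ℕ) :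
    (lineHom φ a v (monomial m 1)).natDegree ≤ m.degree ∧
      (lineHom φ a v (monomial m 1)).coeff m.degree = eval₂ φ v (monomial m 1) := by
  classical
  induction m using Finsupp.induction_linear with
  | zero => simp
  | add m n hm hn =>
    have hmul : monomial (m + n) (1 : R) = monomial m 1 * monomial n 1 := by simp
    rw [hmul, map_mul, map_add, eval₂_mul, ← hm.2, ← hn.2]
    exact ⟨Polynomial.natDegree_mul_le_of_le hm.1 hn.1,
      Polynomial.coeff_mul_add_eq_of_natDegree_le hm.1 hn.1⟩
  | single i k =>
    have hdeg : (Polynomial.C (a i) + Polynomial.C (v i) * Polynomial.X).natDegree ≤ 1 := by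
      compute_degree
    have hpow := Polynomial.coeff_pow_of_natDegree_le (m := k) hdeg
    have hpow' := Polynomial.natDegree_pow_le_of_le k hdeg
    rw [← X_pow_eq_monomial]
    simp_all [lineHom]

lemma natDegree_coeff_lineHom_monomial (φ : R →+* S) (a v : σ → S) (m : σ →₀ ℕ) (c : R) :
    (lineHom φ a v (monomial m c)).natDegree ≤ m.degree ∧
      (lineHom φ a v (monomial m c)).coeff m.degree = eval₂ φ v (monomial m c) := by
  obtain ⟨h1, h2⟩ := natDegree_coeff_lineHom_monomial_one φ a v m
  have hC : lineHom φ a v (C c) = Polynomial.C (φ c) := by simp [lineHom]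
  rw [← mul_one c, ← C_mul_monomial, map_mul, eval₂_mul, ← h2, hC, Polynomial.coeff_C_mul, eval₂_C]
  exact ⟨(Polynomial.natDegree_C_mul_le _ _).trans h1, rfl⟩

/-- The degree `n` coefficient of a polynomial of degree at most `n` along the line `a + t v` is
its homogeneous component of degree `n` evaluated at the direction `v`. -/
lemma coeff_lineHom (φ : R →+* S) (a v : σ → S) {P : MvPolynomial σ R} {n : ℕ}
    (hP : P.totalDegree ≤ n) :
    (lineHom φ a v P).natDegree ≤ n ∧
      (lineHom φ a v P).coeff n = eval₂ φ v (homogeneousComponent n P) := by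
  classical
  have key : ∀ m ∈ P.support, (lineHom φ a v (monomial m (P.coeff m))).natDegree ≤ n ∧
      (lineHom φ a v (monomial m (P.coeff m))).coeff n =
        eval₂ φ v (homogeneousComponent n (monomial m (P.coeff m))) := by
    intro m hm
    obtain ⟨h1, h2⟩ := natDegree_coeff_lineHom_monomial φ a v m (P.coeff m)
    have hmn : m.degree ≤ n := (le_totalDegree hm).trans hP
    refine ⟨h1.trans hmn, ?_⟩
    rcases hmn.eq_or_lt with rfl | hlt
    · rw [h2, homogeneousComponent_of_mem (isHomogeneous_monomial _ rfl), if_pos rfl]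
    · rw [Polynomial.coeff_eq_zero_of_natDegree_lt (h1.trans_lt hlt),
        homogeneousComponent_of_mem (isHomogeneous_monomial _ rfl), if_neg hlt.ne', eval₂_zero]
  rw [P.as_sum, map_sum]
  refine ⟨Polynomial.natDegree_sum_le_of_forall_le _ _ fun m hm => (key m hm).1, ?_⟩
  rw [Polynomial.finsetSum_coeff, map_sum, eval₂_sum]
  exact Finset.sum_congr rfl fun m hm => (key m hm).2

end lineHom

lemma isRelPrime_map_equiv {A B : Type*} [CommRing A] [CommRing B] (e : A ≃+* B) {f g : A} :
    IsRelPrime (e f) (e g) ↔ IsRelPrime f g := by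
  constructor
  · intro h d hf hg
    exact (MulEquiv.isUnit_map e).mp (h (map_dvd e hf) (map_dvd e hg))
  · intro h d hf hg
    have key := h (d := e.symm d) (by simpa using map_dvd e.symm hf)
      (by simpa using map_dvd e.symm hg)
    exact (MulEquiv.isUnit_map e.symm).mp key

lemma isRelPrime_C {A : Type*} [CommRing A] [IsDomain A] {f g : A} (hf : f ≠ 0)
    (h : IsRelPrime f g) : IsRelPrime (Polynomial.C f) (Polynomial.C g) := by
  intro d hdf hdg
  have hd : d.natDegree = 0 := by
    have := Polynomial.natDegree_le_of_dvd hdf (by simpa using hf)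
    simpa using this
  obtain ⟨c, rfl⟩ := Polynomial.natDegree_eq_zero.mp hd
  rw [Polynomial.isUnit_C]
  exact h ((Polynomial.C_dvd_iff_dvd_coeff _ _).mp hdf 0 |>.trans (by simp))
    ((Polynomial.C_dvd_iff_dvd_coeff _ _).mp hdg 0 |>.trans (by simp))

lemma isRelPrime_of_mul_add_mul_eq_C {A : Type*} [CommRing A] [IsDomain A]
    {F G a b : Polynomial A} {ρ : A} (hρ : ρ ≠ 0) (h : F * a + G * b = Polynomial.C ρ) {n : ℕ}
    (hF : IsUnit (F.coeff n)) : IsRelPrime F G := by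
  intro d hdF hdG
  have hd : d.natDegree = 0 := by
    have hdρ : d ∣ Polynomial.C ρ := h ▸ dvd_add (hdF.mul_right _) (hdG.mul_right _)
    simpa using Polynomial.natDegree_le_of_dvd hdρ (by simpa using hρ)
  obtain ⟨c, rfl⟩ := Polynomial.natDegree_eq_zero.mp hd
  rw [Polynomial.isUnit_C]
  exact isUnit_of_dvd_unit ((Polynomial.C_dvd_iff_dvd_coeff _ _).mp hdF n) hF

lemma isCoprime_map_of_isRelPrime {A : Type*} (L : Type*) [CommRing A] [IsDomain A]
    [IsIntegrallyClosed A] [Field L] [Algebra A L] [IsFractionRing A L] {F G : Polynomial A}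
    (hF : IsUnit F.leadingCoeff) (h : IsRelPrime F G) :
    IsCoprime (F.map (algebraMap A L)) (G.map (algebraMap A L)) := by
  obtain ⟨u, hu⟩ := hF
  have hF₁ : (Polynomial.C (↑u⁻¹ : A) * F).Monic := by
    rw [Polynomial.Monic, Polynomial.leadingCoeff_mul, Polynomial.leadingCoeff_C, ← hu]
    simp
  have hu' : IsUnit (Polynomial.C (↑u⁻¹ : A)) := Polynomial.isUnit_C.mpr (Units.isUnit _)
  rw [← isRelPrime_iff_isCoprime]
  intro d hdF hdG
  have hd0 : d ≠ 0 := by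
    rintro rfl
    rw [zero_dvd_iff, Polynomial.map_eq_zero_iff (IsFractionRing.injective A L)] at hdF
    simp [hdF] at hu
  have hdF₁ : d ∣ (Polynomial.C (↑u⁻¹ : A) * F).map (algebraMap A L) := by
    rw [Polynomial.map_mul]
    exact hdF.mul_left _
  obtain ⟨d', hd'⟩ := IsIntegrallyClosed.eq_map_mul_C_of_dvd L hF₁ hdF₁
  have hlc : IsUnit (Polynomial.C d.leadingCoeff) :=
    Polynomial.isUnit_C.mpr (by simpa using hd0)
  have hmonic : d'.Monic := by
    have := congrArg Polynomial.leadingCoeff hd'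
    rw [Polynomial.leadingCoeff_mul, Polynomial.leadingCoeff_C] at this
    have h1 : (d'.map (algebraMap A L)).leadingCoeff = 1 :=
      mul_right_cancel₀ (Polynomial.leadingCoeff_ne_zero.mpr hd0) (by rw [this, one_mul])
    exact Polynomial.monic_of_injective (IsFractionRing.injective A L) h1
  rw [← hd', hlc.mul_right_dvd, Polynomial.map_dvd_map _ (IsFractionRing.injective A L) hmonic]
    at hdF hdG
  rw [← hd']
  exact ((h hdF hdG).map (Polynomial.mapRingHom (algebraMap A L))).mul hlc

/-- The automorphism of `K[x][t]` that fixes `t` and sends `x` to `x + t v`. -/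
noncomputable def shiftEquiv {σ K : Type*} [CommRing K] (v : σ → K) :
    Polynomial (MvPolynomial σ K) ≃+* Polynomial (MvPolynomial σ K) :=
  RingEquiv.ofRingHom
    (Polynomial.eval₂RingHom (lineHom C X fun i => C (v i)) Polynomial.X)
    (Polynomial.eval₂RingHom (lineHom C X fun i => C (-v i)) Polynomial.X)
    (by ext <;> simp [lineHom]) (by ext <;> simp [lineHom])

/-- Elimination along the direction `v`: for coprime `f` and `g`, the ideal generated by
`f (x + t v)` and `g (x + t v)` contains a nonzero polynomial free of `t`. -/
lemma exists_mul_add_mul_eq_C {σ : Type*} {f g : MvPolynomial σ ℤ} (hf : f ≠ 0)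
    (h : IsRelPrime (map (Int.castRingHom ℚ) f) (map (Int.castRingHom ℚ) g)) {v : σ → ℤ}
    (hv : eval v (homogeneousComponent f.totalDegree f) ≠ 0) :
    ∃ a b : Polynomial (MvPolynomial σ ℤ), ∃ ρ : MvPolynomial σ ℤ, ρ ≠ 0 ∧
      lineHom C X (fun i => C (v i)) f * a + lineHom C X (fun i => C (v i)) g * b =
        Polynomial.C ρ := by
  set D := f.totalDegree with hD
  set c := eval v (homogeneousComponent D f) with hc
  set F := lineHom C X (fun i => C (v i)) f with hF
  set G := lineHom C X (fun i => C (v i)) g with hG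
  have hline := coeff_lineHom (C : ℤ →+* MvPolynomial σ ℤ) X (fun i => C (v i)) hD.ge
  have hcoeff : F.coeff D = C c := by
    rw [hline.2, hc]
    exact (eval₂_comp_left C (RingHom.id ℤ) v _).symm
  have hcoeff0 : F.coeff D ≠ 0 := by rwa [hcoeff, Ne, C_eq_zero]
  have hdeg : F.natDegree = D := le_antisymm hline.1 (Polynomial.le_natDegree_of_ne_zero hcoeff0)
  rcases Nat.eq_zero_or_pos D with hD0 | hDpos
  · refine ⟨1, 0, F.coeff 0, hD0 ▸ hcoeff0, ?_⟩
    rw [← Polynomial.eq_C_of_natDegree_eq_zero (hdeg.trans hD0)]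
    ring
  obtain ⟨a, b, -, -, hab⟩ := Polynomial.exists_mul_add_mul_eq_C_resultant F G
    le_rfl le_rfl (by omega)
  refine ⟨a, b, _, ?_, hab⟩
  let ι : MvPolynomial σ ℤ →+* MvPolynomial σ ℚ := map (Int.castRingHom ℚ)
  have hι : Function.Injective ι := map_injective _ Int.cast_injective
  let L := FractionRing (MvPolynomial σ ℚ)
  let κ : MvPolynomial σ ℚ →+* L := algebraMap _ L
  have hκ : Function.Injective κ := IsFractionRing.injective _ L
  have hshift : ∀ P : MvPolynomial σ ℤ, (lineHom C X (fun i => C (v i)) P).map ι =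
      shiftEquiv (fun i => (v i : ℚ)) (Polynomial.C (ι P)) := by
    intro P
    rw [map_lineHom]
    simp only [shiftEquiv, RingEquiv.ofRingHom_apply, Polynomial.coe_eval₂RingHom,
      Polynomial.eval₂_C, ι, lineHom_map]
    congr 2
    · ext; simp
    · ext; simp
    · ext; simp
  have hrel : IsRelPrime (F.map ι) (G.map ι) := by
    rw [hshift, hshift, isRelPrime_map_equiv]
    exact isRelPrime_C ((map_ne_zero_iff ι hι).mpr hf) h
  have hlead : IsUnit (F.map ι).leadingCoeff := by
    rw [Polynomial.leadingCoeff_map_of_injective hι, Polynomial.leadingCoeff, hdeg, hcoeff]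
    have hC : ι (C c) = C (c : ℚ) := map_C _ _
    rw [hC]
    exact (IsUnit.mk0 (c : ℚ) (by exact_mod_cast hv)).map C
  have hcop := isCoprime_map_of_isRelPrime L hlead hrel
  intro h0
  have hres : Polynomial.resultant ((F.map ι).map κ) ((G.map ι).map κ) F.natDegree G.natDegree
      = 0 := by
    rw [Polynomial.resultant_map_map, Polynomial.resultant_map_map, h0, map_zero, map_zero]
  refine Polynomial.resultant_ne_zero _ _ hcop ?_
  rwa [Polynomial.natDegree_map_eq_of_injective hκ, Polynomial.natDegree_map_eq_of_injective hι,
    Polynomial.natDegree_map_eq_of_injective hκ, Polynomial.natDegree_map_eq_of_injective hι]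

/-- Substituting the parametrized plane `y + x₀ v + x₁ w` into a polynomial. -/
noncomputable def planeHom {σ R S : Type*} [CommRing R] [CommRing S] (φ : R →+* S) (y v w : σ → S) :
    MvPolynomial σ R →+* MvPolynomial (Fin 2) S :=
  eval₂Hom (C.comp φ) fun i => C (y i) + C (v i) * X 0 + C (w i) * X 1

section planeHom

variable {σ R S : Type*} [CommRing R] [CommRing S]

lemma totalDegree_planeHom_le (φ : R →+* S) (y v w : σ → S) (P : MvPolynomial σ R) :
    (planeHom φ y v w P).totalDegree ≤ P.totalDegree := by
  classical
  have hlin : ∀ i, (C (y i) + C (v i) * X 0 + C (w i) * X 1 :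
      MvPolynomial (Fin 2) S).totalDegree ≤ 1 := by
    intro i
    have h : ∀ (c : S) (j : Fin 2), (C c * X j : MvPolynomial (Fin 2) S).totalDegree ≤ 1 :=
      fun c j => by
        rw [← pow_one (X j), C_mul_X_pow_eq_monomial]
        exact (totalDegree_monomial_le _ _).trans (by simp)
    refine (totalDegree_add _ _).trans (max_le ((totalDegree_add _ _).trans (max_le ?_ (h _ _)))
      (h _ _))
    simp
  simp only [planeHom, coe_eval₂Hom, eval₂_eq]
  refine totalDegree_finsetSum_le fun m hm => ?_
  refine (totalDegree_mul _ _).trans ?_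
  rw [RingHom.comp_apply, totalDegree_C, zero_add]
  refine (totalDegree_finsetProd _ _).trans (le_trans ?_ (le_totalDegree hm))
  refine Finset.sum_le_sum fun i _ => (totalDegree_pow _ _).trans ?_
  simpa using Nat.mul_le_mul_left (m i) (hlin i)

lemma eval_planeHom (φ : R →+* S) (y v w : σ → S) (P : MvPolynomial σ R) (z : Fin 2 → S) :
    eval z (planeHom φ y v w P) = eval (fun i => y i + v i * z 0 + w i * z 1) (map φ P) := by
  have h : (eval z).comp (planeHom φ y v w) =
      (eval fun i => y i + v i * z 0 + w i * z 1).comp (map φ) := by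
    ext <;> simp [planeHom]
  exact RingHom.congr_fun h P

lemma finSuccEquiv_planeHom (φ : R →+* S) (y v w : σ → S) (P : MvPolynomial σ R) :
    finSuccEquiv S 1 (planeHom φ y v w P) =
      lineHom (C.comp φ) (fun i => C (y i) + C (w i) * X 0) (fun i => C (v i)) P := by
  have h : (finSuccEquiv S 1 : MvPolynomial (Fin 2) S →+* Polynomial (MvPolynomial (Fin 1) S)).comp (planeHom φ y v w) =
      lineHom (C.comp φ) (fun i => C (y i) + C (w i) * X 0) (fun i => C (v i)) := by
    have hX : finSuccEquiv S 1 (X 1) = Polynomial.C (X 0) := finSuccEquiv_X_succ (j := 0)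
    have hC : ∀ c : S, finSuccEquiv S 1 (C c) = Polynomial.C (C c) := fun c =>
      (finSuccEquiv S 1).commutes c
    ext i : 2
    · simp [planeHom, lineHom, hC]
    · simp [planeHom, lineHom, finSuccEquiv_X_zero, hX, hC]
      ring
  exact RingHom.congr_fun h P

end planeHom

lemma exists_eval_homogeneousComponent_ne_zero {σ : Type*} {P : MvPolynomial σ ℤ} (hP : P ≠ 0) :
    ∃ v : σ → ℤ, eval v (homogeneousComponent P.totalDegree P) ≠ 0 := by
  by_contra! h
  have h0 : homogeneousComponent P.totalDegree P = 0 := MvPolynomial.funext fun v => by simp [h v]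
  obtain ⟨m, hm, hdeg⟩ := Finset.exists_mem_eq_sup P.support
    (support_nonempty.mpr hP) fun m => m.sum fun _ e => e
  have := congrArg (coeff m) h0
  rw [coeff_homogeneousComponent, if_pos, coeff_zero] at this
  · exact mem_support_iff.mp hm this
  · exact hdeg.symm

lemma isRelPrime_planeHom {σ K : Type*} [Field K] (φ : ℤ →+* K) {f g ρ : MvPolynomial σ ℤ}
    {a b : Polynomial (MvPolynomial σ ℤ)} {v w : σ → ℤ}
    (hab : lineHom C X (fun i => C (v i)) f * a + lineHom C X (fun i => C (v i)) g * b =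
      Polynomial.C ρ)
    (hv : φ (eval v (homogeneousComponent f.totalDegree f)) ≠ 0)
    (hw : φ (eval w (homogeneousComponent ρ.totalDegree ρ)) ≠ 0) (y : σ → K) :
    IsRelPrime (planeHom φ y (fun i => φ (v i)) (fun i => φ (w i)) f)
      (planeHom φ y (fun i => φ (v i)) (fun i => φ (w i)) g) := by
  rw [← isRelPrime_map_equiv (finSuccEquiv K 1).toRingEquiv]
  let θ : MvPolynomial σ ℤ →+* MvPolynomial (Fin 1) K :=
    eval₂Hom (C.comp φ) fun i => C (y i) + C (φ (w i)) * X 0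
  have hplane : ∀ P, (lineHom C X (fun i => C (v i)) P).map θ =
      finSuccEquiv K 1 (planeHom φ y (fun i => φ (v i)) (fun i => φ (w i)) P) := by
    intro P
    rw [map_lineHom, finSuccEquiv_planeHom]
    congr 2
    · ext; simp
    · ext; simp [θ]
    · ext; simp [θ]
  have hθρ : θ ρ ≠ 0 := by
    intro h0
    let η : MvPolynomial (Fin 1) K →+* Polynomial K :=
      eval₂Hom Polynomial.C fun _ => Polynomial.X
    have hη : η.comp θ = lineHom φ y fun i => φ (w i) := by
      ext <;> simp [θ, η, lineHom, -eq_intCast]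
    have hline : η (θ ρ) = lineHom φ y (fun i => φ (w i)) ρ := RingHom.congr_fun hη ρ
    have hcoeff := (coeff_lineHom φ y (fun i => φ (w i)) (le_refl ρ.totalDegree)).2
    rw [← hline, h0, map_zero, Polynomial.coeff_zero] at hcoeff
    exact hw ((eval₂_comp_left φ (RingHom.id ℤ) w _).trans hcoeff.symm)
  have hcoeff := (coeff_lineHom (C.comp φ) (fun i => C (y i) + C (φ (w i)) * X 0)
    (fun i => (C (φ (v i)) : MvPolynomial (Fin 1) K)) (le_refl f.totalDegree)).2
  have hval : eval₂ (C.comp φ) (fun i => C (φ (v i))) (homogeneousComponent f.totalDegree f) =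
      (C (φ (eval v (homogeneousComponent f.totalDegree f))) : MvPolynomial (Fin 1) K) :=
    (eval₂_comp_left (C.comp φ) (RingHom.id ℤ) v _).symm
  rw [← finSuccEquiv_planeHom, hval] at hcoeff
  refine isRelPrime_of_mul_add_mul_eq_C (a := a.map θ) (b := b.map θ) (n := f.totalDegree) hθρ
    ?_ ?_
  · have := congrArg (Polynomial.map θ) hab
    rwa [Polynomial.map_add, Polynomial.map_mul, Polynomial.map_mul, hplane, hplane,
      Polynomial.map_C] at this
  · exact hcoeff ▸ (IsUnit.mk0 _ hv).map C

/-- If every translate of a parametrized plane meets `Z` in at most `B` parameters, then `Z` has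
density at most `B / |K|²`. -/
lemma card_sq_mul_card_le_of_card_slice_le {ι K : Type*} [Fintype ι] [Field K] [Fintype K]
    [DecidableEq ι] [DecidableEq K] (Z : Finset (ι → K)) (v w : ι → K) {B : ℕ}
    (hB : ∀ y : ι → K, ({z : Fin 2 → K | (fun i => y i + v i * z 0 + w i * z 1) ∈ Z} :
      Finset (Fin 2 → K)).card ≤ B) :
    Fintype.card K ^ 2 * Z.card ≤ Fintype.card K ^ Fintype.card ι * B := by
  have hswap := Finset.sum_card_bipartiteAbove_eq_sum_card_bipartiteBelow
    (s := (Finset.univ : Finset (ι → K))) (t := (Finset.univ : Finset (Fin 2 → K)))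
    (fun y z => (fun i => y i + v i * z 0 + w i * z 1) ∈ Z)
  have htranslate : ∀ z : Fin 2 → K,
      (Finset.bipartiteBelow (fun y z => (fun i => y i + v i * z 0 + w i * z 1) ∈ Z)
        (Finset.univ : Finset (ι → K)) z).card = Z.card := by
    intro z
    refine Finset.card_equiv (Equiv.addRight fun i => v i * z 0 + w i * z 1) fun y => ?_
    have : (fun i => y i + v i * z 0 + w i * z 1) = y + fun i => v i * z 0 + w i * z 1 := by
      ext i
      simp [add_assoc]
    simp [Finset.bipartiteBelow, this]
  rw [Finset.sum_congr rfl fun z _ => htranslate z] at hswap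
  have hle := Finset.sum_le_card_nsmul Finset.univ _ _ fun y _ => hB y
  simp only [Finset.sum_const, Finset.card_univ, Fintype.card_fun, Fintype.card_fin, smul_eq_mul]
    at hswap hle
  exact hswap.symm.trans_le hle

/-- Two integer polynomials coprime over `ℚ` have at most `deg f * deg g * p ^ (r - 2)` common
zeros modulo every sufficiently large prime `p`. -/
theorem card_common_zeros_zmod_le {r : ℕ} (hr : 2 ≤ r) {f g : MvPolynomial (Fin r) ℤ} (hf : f ≠ 0)
    (h : IsRelPrime (map (Int.castRingHom ℚ) f) (map (Int.castRingHom ℚ) g)) :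
    ∃ N : ℕ, ∀ p : ℕ, N ≤ p → p.Prime →
      Nat.card {n : Fin r → ZMod p // eval n (map (Int.castRingHom (ZMod p)) f) = 0 ∧
        eval n (map (Int.castRingHom (ZMod p)) g) = 0} ≤
      f.totalDegree * g.totalDegree * p ^ (r - 2) := by
  classical
  obtain ⟨v, hv⟩ := exists_eval_homogeneousComponent_ne_zero hf
  obtain ⟨a, b, ρ, hρ, hab⟩ := exists_mul_add_mul_eq_C hf h hv
  obtain ⟨w, hw⟩ := exists_eval_homogeneousComponent_ne_zero hρ
  set α := eval v (homogeneousComponent f.totalDegree f)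
  set β := eval w (homogeneousComponent ρ.totalDegree ρ)
  refine ⟨α.natAbs + β.natAbs + 1, fun p hp hprime => ?_⟩
  have : Fact p.Prime := ⟨hprime⟩
  let φ := Int.castRingHom (ZMod p)
  have hcast : ∀ c : ℤ, c ≠ 0 → c.natAbs < p → φ c ≠ 0 := by
    intro c hc hcp h0
    rw [eq_intCast, ZMod.intCast_zmod_eq_zero_iff_dvd, Int.natCast_dvd] at h0
    exact absurd (Nat.le_of_dvd (Int.natAbs_pos.mpr hc) h0) (by omega)
  have hα := hcast α hv (by omega)
  have hβ := hcast β hw (by omega)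
  have hrel := isRelPrime_planeHom φ hab hα hβ
  let Z : Finset (Fin r → ZMod p) := {n | eval n (map φ f) = 0 ∧ eval n (map φ g) = 0}
  have hcard : Nat.card {n : Fin r → ZMod p // eval n (map φ f) = 0 ∧ eval n (map φ g) = 0} =
      Z.card := by
    rw [Nat.card_eq_fintype_card, Fintype.card_subtype]
  have hbound := card_sq_mul_card_le_of_card_slice_le Z (fun i => φ (v i)) (fun i => φ (w i))
    (B := f.totalDegree * g.totalDegree) (by
      intro y
      refine (card_common_zeros_le_of_isRelPrime (hrel y) _ ?_ ?_).trans
        (Nat.mul_le_mul (totalDegree_planeHom_le ..) (totalDegree_planeHom_le ..))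
      · intro z hz
        rw [eval_planeHom]
        simp only [Z, Finset.mem_filter_univ] at hz
        exact hz.1
      · intro z hz
        rw [eval_planeHom]
        simp only [Z, Finset.mem_filter_univ] at hz
        exact hz.2)
  have hpow : p ^ r = p ^ 2 * p ^ (r - 2) := by rw [← pow_add, Nat.add_sub_cancel' hr]
  rw [ZMod.card, Fintype.card_fin, hpow, mul_assoc, mul_comm (p ^ (r - 2))] at hbound
  exact hcard.trans_le (Nat.le_of_mul_le_mul_left hbound (pow_pos hprime.pos 2))

/-- If no nonunit divides all `Q j`, then some integer combination is coprime to a given `f`. -/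
lemma exists_isRelPrime_sum_smul {A ι : Type*} [CommRing A] [IsDomain A]
    [UniqueFactorizationMonoid A] [Algebra ℚ A] [Fintype ι] {f : A} (hf : f ≠ 0) (Q : ι → A)
    (hQ : ∀ q, q ∣ f → (∀ j, q ∣ Q j) → IsUnit q) :
    ∃ u : ι → ℤ, IsRelPrime f (∑ j, u j • Q j) := by
  classical
  by_contra! hall
  let comb : (ι → ℤ) →ₗ[ℤ] A := Fintype.linearCombination ℤ Q
  let W : A → Submodule ℤ (ι → ℤ) := fun q =>
    ((Ideal.span {q}).toAddSubgroup.toIntSubmodule).comap comb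
  have hW : ∀ q u, u ∈ W q ↔ q ∣ ∑ j, u j • Q j := fun q u => Ideal.mem_span_singleton
  obtain ⟨q, hq, hfin⟩ := Submodule.exists_finiteIndex_of_cover
    (s := (UniqueFactorizationMonoid.factors f).toFinset) (p := W) (by
      refine Set.eq_univ_of_forall fun u => ?_
      have hu := hall u
      rw [UniqueFactorizationMonoid.isRelPrime_iff_no_prime_factors hf] at hu
      push Not at hu
      obtain ⟨d, hdf, hdg, hd⟩ := hu
      obtain ⟨q, hq, hdq⟩ :=
        UniqueFactorizationMonoid.exists_mem_factors_of_dvd hf hd.irreducible hdf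
      simp only [Set.mem_iUnion]
      exact ⟨q, Multiset.mem_toFinset.mpr hq, (hW q u).mpr (hdq.symm.dvd.trans hdg)⟩)
  rw [Multiset.mem_toFinset] at hq
  refine (UniqueFactorizationMonoid.irreducible_of_factor q hq).not_isUnit (hQ q
    (UniqueFactorizationMonoid.dvd_of_mem_factors hq) fun j => ?_)
  have hmem := AddSubgroup.nsmul_index_mem (W q).toAddSubgroup (Pi.single j (1 : ℤ))
  set m := (W q).toAddSubgroup.index
  have hm : m ≠ 0 := hfin.index_ne_zero
  have hdvd := (hW q _).mp hmem
  have hunit : IsUnit (algebraMap ℚ A m) := (IsUnit.mk0 (m : ℚ) (by exact_mod_cast hm)).map _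
  have hsum : ∑ i, (m • (Pi.single j (1 : ℤ) : ι → ℤ)) i • Q i = algebraMap ℚ A m * Q j := by
    rw [Finset.sum_eq_single j]
    · simp
    · intro i _ hij
      simp [hij]
    · simp
  rwa [hsum, hunit.dvd_mul_left] at hdvd

/-- Bound on the number of common zeros mod `p`: for nonzero coprime polynomials
of total degree at most `d` in `r ≥ 2` variables, `c_p ≤ d^s · p^(r-2)` for all
sufficiently large primes `p`; consequently `c_p/p^r = O(1/p²)`. -/
theorem stmt18 (s r d : ℕ) (hs : 2 ≤ s) (hr : 2 ≤ r)
    (P : Fin s → MvPolynomial (Fin r) ℤ)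
    (hP : ∀ i, P i ≠ 0)
    (hd : ∀ i, (P i).totalDegree ≤ d)
    (hcop : ∀ D : MvPolynomial (Fin r) ℚ,
      (∀ i, D ∣ (P i).map (Int.castRingHom ℚ)) → D.totalDegree = 0) :
    (∃ N : ℕ, ∀ p : ℕ, N ≤ p → p.Prime →
      Nat.card {n : Fin r → ZMod p //
          ∀ i, eval n ((P i).map (Int.castRingHom (ZMod p))) = 0}
        ≤ d ^ s * p ^ (r - 2)) ∧
    ∃ C : ℝ, ∀ p : ℕ, p.Prime →
      (Nat.card {n : Fin r → ZMod p //
          ∀ i, eval n ((P i).map (Int.castRingHom (ZMod p))) = 0} : ℝ) / (p : ℝ) ^ r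
        ≤ C / (p : ℝ) ^ 2 := by
  obtain ⟨t, rfl⟩ : ∃ t, s = t + 1 := ⟨s - 1, by omega⟩
  have hfirst : ∃ N : ℕ, ∀ p : ℕ, N ≤ p → p.Prime →
      Nat.card {n : Fin r → ZMod p //
          ∀ i, eval n ((P i).map (Int.castRingHom (ZMod p))) = 0}
        ≤ d ^ (t + 1) * p ^ (r - 2) := by
    have hP0 : map (Int.castRingHom ℚ) (P 0) ≠ 0 :=
      (map_ne_zero_iff _ (map_injective _ Int.cast_injective)).mpr (hP 0)
    obtain ⟨u, hu⟩ := exists_isRelPrime_sum_smul hP0 (fun j => map (Int.castRingHom ℚ) (P j))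
      (by
        intro q hq0 hq
        have hC := totalDegree_eq_zero_iff_eq_C.mp (hcop q hq)
        have hq_ne : q ≠ 0 := ne_zero_of_dvd_ne_zero hP0 hq0
        rw [hC] at hq_ne ⊢
        exact (IsUnit.mk0 _ (by simpa using hq_ne)).map C)
    set g : MvPolynomial (Fin r) ℤ := ∑ j, u j • P j with hg
    have hgd : g.totalDegree ≤ d := totalDegree_finsetSum_le fun j _ =>
      (totalDegree_smul_le _ _).trans (hd j)
    obtain ⟨N, hN⟩ := card_common_zeros_zmod_le hr (hP 0) (g := g) (by simpa [hg] using hu)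
    refine ⟨N, fun p hp hprime => ?_⟩
    have : Fact p.Prime := ⟨hprime⟩
    refine le_trans ?_ ((hN p hp hprime).trans (Nat.mul_le_mul_right _ ?_))
    · refine Nat.card_le_card_of_injective
        (fun n => ⟨n.1, n.2 0, by simp [hg, n.2]⟩) fun n n' h => ?_
      simpa [Subtype.ext_iff] using h
    · refine (Nat.mul_le_mul (hd 0) hgd).trans ?_
      rcases Nat.eq_zero_or_pos d with rfl | hdpos
      · simp
      · rw [← sq]
        exact Nat.pow_le_pow_right hdpos hs
  refine ⟨hfirst, ?_⟩
  obtain ⟨N, hN⟩ := hfirst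
  refine ⟨(d : ℝ) ^ (t + 1) + (N : ℝ) ^ 2, fun p hprime => ?_⟩
  have : Fact p.Prime := ⟨hprime⟩
  have hp0 : (0 : ℝ) < p := by exact_mod_cast hprime.pos
  have hpow : (p : ℝ) ^ r = (p : ℝ) ^ (r - 2) * (p : ℝ) ^ 2 := by
    rw [← pow_add, Nat.sub_add_cancel hr]
  rw [div_le_div_iff₀ (by positivity) (by positivity), hpow, ← mul_assoc]
  refine mul_le_mul_of_nonneg_right ?_ (by positivity)
  rcases le_or_gt N p with hNp | hpN
  · have hle : (Nat.card {n : Fin r → ZMod p //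
        ∀ i, eval n ((P i).map (Int.castRingHom (ZMod p))) = 0} : ℝ) ≤
        (d : ℝ) ^ (t + 1) * (p : ℝ) ^ (r - 2) := by exact_mod_cast hN p hNp hprime
    refine hle.trans (mul_le_mul_of_nonneg_right ?_ (by positivity))
    linarith [sq_nonneg (N : ℝ)]
  · have hle : (Nat.card {n : Fin r → ZMod p //
        ∀ i, eval n ((P i).map (Int.castRingHom (ZMod p))) = 0} : ℝ) ≤ (p : ℝ) ^ r := by
      have := Nat.card_le_card_of_injective (Subtype.val : {n : Fin r → ZMod p //
        ∀ i, eval n ((P i).map (Int.castRingHom (ZMod p))) = 0} → _) Subtype.val_injective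
      rw [Nat.card_fun] at this
      simp only [Nat.card_eq_fintype_card, ZMod.card, Fintype.card_fin] at this ⊢
      exact_mod_cast this
    refine hle.trans ?_
    rw [hpow, mul_comm]
    refine mul_le_mul_of_nonneg_right ?_ (by positivity)
    have hpN' : (p : ℝ) ≤ N := by exact_mod_cast hpN.le
    have : (p : ℝ) ^ 2 ≤ (N : ℝ) ^ 2 := by gcongr
    have : (0 : ℝ) ≤ (d : ℝ) ^ (t + 1) := by positivity
    linarith
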